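/- arXiv:2111.09434 — 2 statements merged into one kernel-verified Lean document; each statement's English description precedes it below -/
import Mathlib

section
/- Let A, Â ∈ ℝ^{n×n} with ‖A − Â‖ ≤ ε_A, and let Q, S, Ŝ ∈ ℝ^{n×n} be symmetric positive semidefinite (so that I + SQ and I + ŜQ are invertible). Then ‖AᵀQ(I + SQ)⁻¹A − ÂᵀQ(I + ŜQ)⁻¹Â‖ ≤ ‖A‖²‖Q‖²‖Ŝ − S‖ + 2‖A‖‖Q‖ε_A + ‖Q‖ε_A². -/
open Matrix

/-- The operator norm of a real matrix induced by the Euclidean vector norm. -/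
noncomputable def mnorm {m n : ℕ} (A : Matrix (Fin m) (Fin n) ℝ) : ℝ :=
  ‖LinearMap.toContinuousLinearMap (Matrix.toEuclideanLin A)‖

/-- The Euclidean norm of a real vector. -/
noncomputable def vnorm {n : ℕ} (x : Fin n → ℝ) : ℝ :=
  Real.sqrt (∑ i, x i ^ 2)
open scoped Matrix.Norms.L2Operator in
lemma aux_mnorm {m n : ℕ} (A : Matrix (Fin m) (Fin n) ℝ) : mnorm A = ‖A‖ := rfl

/-- euclidean norm -/
noncomputable def enrm {n : ℕ} (x : Fin n → ℝ) : ℝ := ‖WithLp.toLp 2 x‖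

lemma enrm_nonneg {n : ℕ} (x : Fin n → ℝ) : 0 ≤ enrm x := norm_nonneg _

lemma enrm_sq {n : ℕ} (x : Fin n → ℝ) : enrm x ^ 2 = x ⬝ᵥ x := by
  unfold enrm
  rw [← real_inner_self_eq_norm_sq, EuclideanSpace.inner_toLp_toLp]
  simp

lemma dot_le {n : ℕ} (x y : Fin n → ℝ) : x ⬝ᵥ y ≤ enrm x * enrm y := by
  have h := real_inner_le_norm (WithLp.toLp 2 y) (WithLp.toLp 2 x)
  rw [EuclideanSpace.inner_toLp_toLp] at h
  simp only [star_trivial] at h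
  unfold enrm
  linarith

open scoped Matrix.Norms.L2Operator in
lemma enrm_mulVec {n : ℕ} (A : Matrix (Fin n) (Fin n) ℝ) (x : Fin n → ℝ) :
    enrm (A *ᵥ x) ≤ ‖A‖ * enrm x :=
  Matrix.l2_opNorm_mulVec A (WithLp.toLp 2 x)

open scoped Matrix.Norms.L2Operator MatrixOrder in
lemma psd_factor {n : ℕ} {Q : Matrix (Fin n) (Fin n) ℝ} (hQ : Q.PosSemidef) :
    ∃ B : Matrix (Fin n) (Fin n) ℝ, Q = Bᴴ * B :=
  CStarAlgebra.nonneg_iff_eq_star_mul_self.1 hQ.nonneg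

open scoped Matrix.Norms.L2Operator in
lemma key {n : ℕ} {Q S : Matrix (Fin n) (Fin n) ℝ} (hQ : Q.PosSemidef) (hS : S.PosSemidef)
    (x : Fin n → ℝ) : enrm (Q *ᵥ x) ≤ ‖Q‖ * enrm ((1 + S * Q) *ᵥ x) := by
  have h1 : enrm (Q *ᵥ x) ^ 2 ≤ ‖Q‖ * (x ⬝ᵥ (Q *ᵥ x)) := by
    obtain ⟨B, hB⟩ := psd_factor hQ
    have hn : ‖Q‖ = ‖B‖ * ‖B‖ := by rw [hB, Matrix.l2_opNorm_conjTranspose_mul_self]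
    have e1 : Q *ᵥ x = Bᴴ *ᵥ (B *ᵥ x) := by rw [hB, Matrix.mulVec_mulVec]
    have e2 : x ⬝ᵥ (Q *ᵥ x) = enrm (B *ᵥ x) ^ 2 := by
      rw [e1, enrm_sq, Matrix.dotProduct_mulVec, Matrix.conjTranspose_eq_transpose_of_trivial,
        Matrix.vecMul_transpose]
    have h := enrm_mulVec Bᴴ (B *ᵥ x)
    rw [Matrix.l2_opNorm_conjTranspose] at h
    rw [e2, hn, e1]
    calc _ ≤ (‖B‖ * enrm (B *ᵥ x)) ^ 2 := pow_le_pow_left₀ (enrm_nonneg _) h 2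
      _ = _ := by ring
  have h2 : x ⬝ᵥ (Q *ᵥ x) ≤ enrm ((1 + S * Q) *ᵥ x) * enrm (Q *ᵥ x) := by
    refine le_trans ?_ (dot_le _ _)
    rw [Matrix.add_mulVec, Matrix.one_mulVec, add_dotProduct, ← Matrix.mulVec_mulVec]
    have := hS.dotProduct_mulVec_nonneg (Q *ᵥ x)
    rw [star_trivial, dotProduct_comm] at this
    linarith
  rcases (enrm_nonneg (Q *ᵥ x)).eq_or_lt with h0 | h0
  · rw [← h0]; exact mul_nonneg (norm_nonneg _) (enrm_nonneg _)
  · have h3 := h1.trans (mul_le_mul_of_nonneg_left h2 (norm_nonneg Q))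
    refine le_of_mul_le_mul_right ?_ h0
    nlinarith

lemma key_unit {n : ℕ} {Q S : Matrix (Fin n) (Fin n) ℝ} (hQ : Q.PosSemidef) (hS : S.PosSemidef) :
    IsUnit (1 + S * Q) := by
  rw [← Matrix.mulVec_injective_iff_isUnit]
  rw [← Matrix.coe_mulVecLin]
  refine (injective_iff_map_eq_zero _).2 fun x hx => ?_
  rw [Matrix.mulVecLin_apply] at hx
  have h := key hQ hS x
  rw [hx] at h
  have h0 : enrm (0 : Fin n → ℝ) = 0 := by simp [enrm]
  rw [h0, mul_zero] at h
  have h1 : Q *ᵥ x = 0 := by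
    have h2 : enrm (Q *ᵥ x) = 0 := le_antisymm h (enrm_nonneg _)
    have h3 := enrm_sq (Q *ᵥ x)
    rw [h2] at h3
    exact dotProduct_self_eq_zero.1 (by rw [← h3]; norm_num)
  rw [Matrix.add_mulVec, Matrix.one_mulVec, ← Matrix.mulVec_mulVec, h1, Matrix.mulVec_zero,
    add_zero] at hx
  exact hx

open scoped Matrix.Norms.L2Operator in
lemma key_norm {n : ℕ} {Q S : Matrix (Fin n) (Fin n) ℝ} (hQ : Q.PosSemidef) (hS : S.PosSemidef) :
    ‖Q * (1 + S * Q)⁻¹‖ ≤ ‖Q‖ := by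
  rw [Matrix.l2_opNorm_def]
  refine ContinuousLinearMap.opNorm_le_bound _ (norm_nonneg Q) fun y => ?_
  have hu := (Matrix.isUnit_iff_isUnit_det _).1 (key_unit hQ hS)
  have h := key hQ hS ((1 + S * Q)⁻¹ *ᵥ y.ofLp)
  rw [Matrix.mulVec_mulVec, Matrix.mulVec_mulVec, Matrix.mul_nonsing_inv _ hu,
    Matrix.one_mulVec] at h
  exact h

open scoped Matrix.Norms.L2Operator in
lemma main_aux
    (n : ℕ) (A Ahat Q S Shat : Matrix (Fin n) (Fin n) ℝ) (εA : ℝ)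
    (hQ : Q.PosSemidef) (hS : S.PosSemidef) (hShat : Shat.PosSemidef)
    (hA : mnorm (A - Ahat) ≤ εA) :
    mnorm (Aᵀ * Q * (1 + S * Q)⁻¹ * A - Ahatᵀ * Q * (1 + Shat * Q)⁻¹ * Ahat) ≤
      mnorm A ^ 2 * mnorm Q ^ 2 * mnorm (Shat - S) +
        2 * mnorm A * mnorm Q * εA + mnorm Q * εA ^ 2 := by
  have hu := (Matrix.isUnit_iff_isUnit_det _).1 (key_unit hQ hS)
  have hu' := (Matrix.isUnit_iff_isUnit_det _).1 (key_unit hQ hShat)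
  have hP := key_norm hQ hS
  have hP' := key_norm hQ hShat
  have hd : Q * (1 + S * Q)⁻¹ - Q * (1 + Shat * Q)⁻¹ =
      Q * (1 + S * Q)⁻¹ * (Shat - S) * (Q * (1 + Shat * Q)⁻¹) := by
    have e : (Shat - S) * Q = (1 + Shat * Q) - (1 + S * Q) := by noncomm_ring
    calc _ = Q * (1 + S * Q)⁻¹ * ((1 + Shat * Q) * (1 + Shat * Q)⁻¹)
          - Q * ((1 + S * Q)⁻¹ * (1 + S * Q)) * (1 + Shat * Q)⁻¹ := by
            rw [Matrix.mul_nonsing_inv _ hu', Matrix.nonsing_inv_mul _ hu, mul_one, mul_one]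
      _ = Q * (1 + S * Q)⁻¹ * ((1 + Shat * Q) - (1 + S * Q)) * (1 + Shat * Q)⁻¹ := by
            simp only [mul_sub, sub_mul, mul_assoc]
      _ = _ := by rw [← e]; simp only [mul_assoc]
  simp only [aux_mnorm] at *
  rw [mul_assoc Aᵀ, mul_assoc Ahatᵀ]
  generalize Q * (1 + S * Q)⁻¹ = P at *
  generalize Q * (1 + Shat * Q)⁻¹ = P' at *
  obtain ⟨D, hD⟩ : ∃ D, D = A - Ahat := ⟨_, rfl⟩
  have hAh : Ahat = A - D := by rw [hD]; abel
  rw [← hD] at hA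
  have e : Aᵀ * P * A - Ahatᵀ * P' * Ahat =
      Aᵀ * (P * (Shat - S) * P') * A + Aᵀ * P' * D + Dᵀ * P' * A - Dᵀ * P' * D := by
    rw [← hd, hAh, Matrix.transpose_sub]; noncomm_ring
  have ht : ∀ M : Matrix (Fin n) (Fin n) ℝ, ‖Mᵀ‖ = ‖M‖ := fun M => by
    rw [← Matrix.conjTranspose_eq_transpose_of_trivial, Matrix.l2_opNorm_conjTranspose]
  have h3 : ∀ (X Y Z : Matrix (Fin n) (Fin n) ℝ) (a b c : ℝ), ‖X‖ ≤ a → ‖Y‖ ≤ b → ‖Z‖ ≤ c →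
      ‖X * Y * Z‖ ≤ a * b * c := fun X Y Z a b c ha hb hc => by
    have ha0 := (norm_nonneg X).trans ha
    have hb0 := (norm_nonneg Y).trans hb
    exact (norm_mul_le _ _).trans (mul_le_mul ((norm_mul_le _ _).trans
      (mul_le_mul ha hb (norm_nonneg _) ha0)) hc (norm_nonneg _) (mul_nonneg ha0 hb0))
  have b1 := h3 Aᵀ _ A _ _ _ (ht A).le (h3 P (Shat - S) P' _ _ _ hP le_rfl hP') le_rfl
  have b2 := h3 Aᵀ P' D _ _ _ (ht A).le hP' hA
  have b3 := h3 Dᵀ P' A _ _ _ ((ht D).le.trans hA) hP' le_rfl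
  have b4 := h3 Dᵀ P' D _ _ _ ((ht D).le.trans hA) hP' hA
  rw [e]
  refine (norm_sub_le _ _).trans ?_
  have n1 := norm_add_le (Aᵀ * (P * (Shat - S) * P') * A + Aᵀ * P' * D) (Dᵀ * P' * A)
  have n2 := norm_add_le (Aᵀ * (P * (Shat - S) * P') * A) (Aᵀ * P' * D)
  linarith

/-- Lemma 6 of the paper, from Mania et al..
For `‖A - Â‖ ≤ ε_A` and symmetric positive semidefinite `Q, S, Ŝ`,
`‖AᵀQ(I + SQ)⁻¹A - ÂᵀQ(I + ŜQ)⁻¹Â‖ ≤ ‖A‖²‖Q‖²‖Ŝ - S‖ + 2‖A‖‖Q‖ε_A + ‖Q‖ε_A²`. -/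
theorem statement5
    (n : ℕ) (A Ahat Q S Shat : Matrix (Fin n) (Fin n) ℝ) (εA : ℝ)
    (hQ : Q.PosSemidef) (hS : S.PosSemidef) (hShat : Shat.PosSemidef)
    (hA : mnorm (A - Ahat) ≤ εA) :
    mnorm (Aᵀ * Q * (1 + S * Q)⁻¹ * A - Ahatᵀ * Q * (1 + Shat * Q)⁻¹ * Ahat) ≤
      mnorm A ^ 2 * mnorm Q ^ 2 * mnorm (Shat - S) +
        2 * mnorm A * mnorm Q * εA + mnorm Q * εA ^ 2 := by
  exact main_aux n A Ahat Q S Shat εA hQ hS hShat hA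
end

section
/- Let N₁, N₂, M ∈ ℝ^{n×n} be symmetric positive semidefinite matrices (so that I + MN₁, I + MN₂ and I + N₁M are invertible). Then ‖N₁(I + MN₁)⁻¹ − N₂(I + MN₂)⁻¹‖ ≤ ‖(I + MN₁)⁻¹‖ · ‖N₁ − N₂‖ · ‖(I + MN₂)⁻¹‖. -/
open Matrix

theorem aux_unit {n : ℕ} {N M : Matrix (Fin n) (Fin n) ℝ}
    (hN : N.PosSemidef) (hM : M.PosSemidef) : IsUnit (1 + M * N).det := by
  rw [isUnit_iff_ne_zero]
  intro h
  obtain ⟨x, hx0, hx⟩ := Matrix.exists_mulVec_eq_zero_iff.2 h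
  apply hx0
  rw [Matrix.add_mulVec, Matrix.one_mulVec, ← Matrix.mulVec_mulVec] at hx
  have h1 := hN.dotProduct_mulVec_nonneg x
  have h2 := hM.dotProduct_mulVec_nonneg (N *ᵥ x)
  have h3 : (N *ᵥ x) ⬝ᵥ x + (N *ᵥ x) ⬝ᵥ (M *ᵥ (N *ᵥ x)) = 0 := by
    rw [← dotProduct_add, hx, dotProduct_zero]
  rw [dotProduct_comm (N *ᵥ x) x] at h3
  simp only [star_trivial] at h1 h2
  have h4 : star x ⬝ᵥ (N *ᵥ x) = 0 := by
    simp only [star_trivial]; linarith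
  have h5 := (hN.dotProduct_mulVec_zero_iff x).1 h4
  simpa [h5] using hx

open scoped Matrix.Norms.L2Operator in
theorem mnorm_eq_norm {n : ℕ} (A : Matrix (Fin n) (Fin n) ℝ) : mnorm A = ‖A‖ := rfl

open scoped Matrix.Norms.L2Operator in
theorem mnorm_mul_le {n : ℕ} (A B : Matrix (Fin n) (Fin n) ℝ) :
    mnorm (A * B) ≤ mnorm A * mnorm B := by
  simp only [mnorm_eq_norm]
  exact Matrix.l2_opNorm_mul A B

open scoped Matrix.Norms.L2Operator in
theorem mnorm_transpose {n : ℕ} (A : Matrix (Fin n) (Fin n) ℝ) :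
    mnorm Aᵀ = mnorm A := by
  simp only [mnorm_eq_norm]
  rw [← Matrix.conjTranspose_eq_transpose_of_trivial]
  exact Matrix.l2_opNorm_conjTranspose A

/-- Lemma 7 of the paper.
For symmetric positive semidefinite `N₁, N₂, M`,
`‖N₁(I + MN₁)⁻¹ - N₂(I + MN₂)⁻¹‖ ≤ ‖(I + MN₁)⁻¹‖ ‖N₁ - N₂‖ ‖(I + MN₂)⁻¹‖`. -/
theorem statement6
    (n : ℕ) (N₁ N₂ M : Matrix (Fin n) (Fin n) ℝ)
    (hN₁ : N₁.PosSemidef) (hN₂ : N₂.PosSemidef) (hM : M.PosSemidef) :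
    mnorm (N₁ * (1 + M * N₁)⁻¹ - N₂ * (1 + M * N₂)⁻¹) ≤
      mnorm ((1 + M * N₁)⁻¹) * mnorm (N₁ - N₂) * mnorm ((1 + M * N₂)⁻¹) := by
  have u1 := aux_unit hN₁ hM
  have u2 := aux_unit hN₂ hM
  have hT : (1 + M * N₁)ᵀ = 1 + N₁ * M := by
    have e1 : N₁ᵀ = N₁ := by
      rw [← Matrix.conjTranspose_eq_transpose_of_trivial]; exact hN₁.isHermitian
    have e2 : Mᵀ = M := by
      rw [← Matrix.conjTranspose_eq_transpose_of_trivial]; exact hM.isHermitian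
    rw [transpose_add, transpose_one, transpose_mul, e1, e2]
  have u3 : IsUnit (1 + N₁ * M).det := by rw [← hT, det_transpose]; exact u1
  have hTi : ((1 + M * N₁)⁻¹)ᵀ = (1 + N₁ * M)⁻¹ := by
    rw [transpose_nonsing_inv, hT]
  have key : N₁ * (1 + M * N₁)⁻¹ - N₂ * (1 + M * N₂)⁻¹
      = (1 + N₁ * M)⁻¹ * (N₁ - N₂) * (1 + M * N₂)⁻¹ := by
    have a1 : N₁ * (1 + M * N₁)⁻¹ = (1 + N₁ * M)⁻¹ * N₁ := by
      calc N₁ * (1 + M * N₁)⁻¹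
          = (1 + N₁ * M)⁻¹ * (1 + N₁ * M) * N₁ * (1 + M * N₁)⁻¹ := by
            rw [nonsing_inv_mul _ u3, one_mul]
        _ = (1 + N₁ * M)⁻¹ * N₁ * ((1 + M * N₁) * (1 + M * N₁)⁻¹) := by
            noncomm_ring
        _ = _ := by rw [mul_nonsing_inv _ u1, mul_one]
    calc N₁ * (1 + M * N₁)⁻¹ - N₂ * (1 + M * N₂)⁻¹
        = (1 + N₁ * M)⁻¹ * N₁ * ((1 + M * N₂) * (1 + M * N₂)⁻¹)
          - ((1 + N₁ * M)⁻¹ * (1 + N₁ * M)) * N₂ * (1 + M * N₂)⁻¹ := by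
          rw [nonsing_inv_mul _ u3, mul_nonsing_inv _ u2, one_mul, mul_one, a1]
      _ = _ := by noncomm_ring
  rw [key, ← hTi]
  refine (mnorm_mul_le _ _).trans ?_
  refine mul_le_mul_of_nonneg_right ?_ (norm_nonneg _)
  refine (mnorm_mul_le _ _).trans ?_
  rw [mnorm_transpose]
end
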